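/- Let ρ₁, ρ₂ : (0,a) → [δ,1] with δ > 0 and suppose ∫₀^a ρ₂ ≥ ∫₀^a ρ₁. Then for every k, μ_k(ρ₁, ρ₂) ≤ μ_k(ρ₁, αρ₂) ≤ μ_k(1, αρ₂) where α ∈ (0,1) is chosen so that α∫₀^a ρ₂ = ∫₀^a ρ₁; hence μ_k(ρ₁,ρ₂) ≤ π²k²/(∫₀^a ρ₁)². -/

import Mathlib

open MeasureTheory Set ENNReal Real

/-- The indicator of a set, as a linear map on real-valued functions. -/
noncomputable def indicatorL {α : Type*} (s : Set α) : (α → ℝ) →ₗ[ℝ] (α → ℝ) where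
  toFun f := s.indicator f
  map_add' f g := by ext x; by_cases h : x ∈ s <;> simp [Set.indicator_apply, h]
  map_smul' c f := by ext x; by_cases h : x ∈ s <;> simp [Set.indicator_apply, h]

/-- The `k`-th min-max eigenvalue of the Sturm-Liouville problem
`-(ρ₁ u')' = μ ρ₂ u` with Neumann conditions on the interval `(α, β)`:
the infimum, over subspaces of `C¹` functions whose restriction to `(α,β)` is
`(k+1)`-dimensional, of the maximum of the Rayleigh quotient
`(∫_α^β ρ₁ u'²)/(∫_α^β ρ₂ u²)` over nonzero elements. -/
noncomputable def muSL (k : ℕ) (α β : ℝ) (ρ₁ ρ₂ : ℝ → ℝ) : ℝ≥0∞ :=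
  ⨅ V : {V : Submodule ℝ (ℝ → ℝ) //
      (∀ u ∈ V, ContDiff ℝ 1 u) ∧
      Module.finrank ℝ (V.map (indicatorL (Set.Ioo α β))) = k + 1},
    ⨆ u : {u : ℝ → ℝ // u ∈ V.1 ∧ indicatorL (Set.Ioo α β) u ≠ 0},
    ENNReal.ofReal ((∫ x in Set.Ioo α β, ρ₁ x * (deriv u.1 x) ^ 2) /
      (∫ x in Set.Ioo α β, ρ₂ x * (u.1 x) ^ 2))

theorem muSL_mono {k : ℕ} {α β : ℝ} {ρ₁ ρ₂ σ₁ σ₂ : ℝ → ℝ}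
    (h : ∀ u : ℝ → ℝ, ContDiff ℝ 1 u →
      (∫ x in Set.Ioo α β, ρ₁ x * (deriv u x) ^ 2) / (∫ x in Set.Ioo α β, ρ₂ x * (u x) ^ 2) ≤
      (∫ x in Set.Ioo α β, σ₁ x * (deriv u x) ^ 2) / (∫ x in Set.Ioo α β, σ₂ x * (u x) ^ 2)) :
    muSL k α β ρ₁ ρ₂ ≤ muSL k α β σ₁ σ₂ :=
  iInf_mono fun V => iSup_mono fun u => ENNReal.ofReal_le_ofReal (h u.1 (V.2.1 u.1 u.2.1))

theorem integral_cos_int_mul (n : ℤ) :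
    ∫ x in (0 : ℝ)..π, cos (n * x) = if n = 0 then π else 0 := by
  split_ifs with h
  · simp [h]
  · have h' : (n : ℝ) ≠ 0 := by exact_mod_cast h
    rw [intervalIntegral.integral_comp_mul_left (fun x => cos x) h']
    simp [Real.sin_int_mul_pi]

theorem integral_cos_mul_cos (i j : ℕ) :
    ∫ x in (0 : ℝ)..π, cos (i * x) * cos (j * x) =
      if i = j then (if i = 0 then π else π / 2) else 0 := by
  have e : ∀ x : ℝ, cos (i * x) * cos (j * x) =
      (1 / 2) * (cos (((i - j : ℤ) : ℝ) * x) + cos (((i + j : ℤ) : ℝ) * x)) := by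
    intro x
    push_cast
    rw [sub_mul, add_mul, cos_sub, cos_add]
    ring
  simp_rw [e]
  rw [intervalIntegral.integral_const_mul, intervalIntegral.integral_add
    (Continuous.intervalIntegrable (by fun_prop) _ _)
    (Continuous.intervalIntegrable (by fun_prop) _ _), integral_cos_int_mul, integral_cos_int_mul]
  split_ifs <;> first | omega | ring

theorem integral_sin_mul_sin (i j : ℕ) :
    ∫ x in (0 : ℝ)..π, sin (i * x) * sin (j * x) =
      if i = j then (if i = 0 then 0 else π / 2) else 0 := by
  have e : ∀ x : ℝ, sin (i * x) * sin (j * x) =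
      (1 / 2) * (cos (((i - j : ℤ) : ℝ) * x) - cos (((i + j : ℤ) : ℝ) * x)) := by
    intro x
    push_cast
    rw [sub_mul, add_mul, cos_sub, cos_add]
    ring
  simp_rw [e]
  rw [intervalIntegral.integral_const_mul, intervalIntegral.integral_sub
    (Continuous.intervalIntegrable (by fun_prop) _ _)
    (Continuous.intervalIntegrable (by fun_prop) _ _), integral_cos_int_mul, integral_cos_int_mul]
  split_ifs <;> first | omega | ring

/-- The cosine polynomial `∑ c_j cos (j θ)` of degree at most `k`. -/
noncomputable def cosPoly {k : ℕ} (c : Fin (k + 1) → ℝ) (θ : ℝ) : ℝ :=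
  ∑ j, c j * cos ((j : ℕ) * θ)

/-- The derivative of `cosPoly c`. -/
noncomputable def cosPolyDeriv {k : ℕ} (c : Fin (k + 1) → ℝ) (θ : ℝ) : ℝ :=
  ∑ j : Fin (k + 1), -((j : ℕ) * c j) * sin ((j : ℕ) * θ)

section CosPoly

variable {k : ℕ} (c : Fin (k + 1) → ℝ)

theorem contDiff_cosPoly : ContDiff ℝ 1 (cosPoly c) := by
  unfold cosPoly
  fun_prop

theorem continuous_cosPolyDeriv : Continuous (cosPolyDeriv c) := by
  unfold cosPolyDeriv
  fun_prop

theorem hasDerivAt_cosPoly (θ : ℝ) : HasDerivAt (cosPoly c) (cosPolyDeriv c θ) θ := by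
  unfold cosPoly cosPolyDeriv
  refine HasDerivAt.fun_sum fun j _ => ?_
  have h := (((hasDerivAt_id θ).const_mul ((j : ℕ) : ℝ)).cos).const_mul (c j)
  exact h.congr_deriv (by simp only [id]; ring)

theorem integral_cosPoly_sq :
    ∫ x in (0 : ℝ)..π, cosPoly c x ^ 2 =
      ∑ j : Fin (k + 1), c j ^ 2 * (if (j : ℕ) = 0 then π else π / 2) := by
  have e : ∀ x, cosPoly c x ^ 2 =
      ∑ i, ∑ j, c i * c j * (cos ((i : ℕ) * x) * cos ((j : ℕ) * x)) := by
    intro x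
    rw [cosPoly, sq, Finset.sum_mul_sum]
    exact Finset.sum_congr rfl fun i _ => Finset.sum_congr rfl fun j _ => by ring
  simp_rw [e]
  rw [intervalIntegral.integral_finsetSum
    fun i _ => Continuous.intervalIntegrable (by fun_prop) _ _]
  refine Finset.sum_congr rfl fun i _ => ?_
  rw [intervalIntegral.integral_finsetSum
    fun i _ => Continuous.intervalIntegrable (by fun_prop) _ _]
  simp_rw [intervalIntegral.integral_const_mul, integral_cos_mul_cos, Fin.val_inj]
  simp [sq]

theorem integral_cosPolyDeriv_sq :
    ∫ x in (0 : ℝ)..π, cosPolyDeriv c x ^ 2 =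
      ∑ j : Fin (k + 1), ((j : ℕ) * c j) ^ 2 * (if (j : ℕ) = 0 then 0 else π / 2) := by
  have e : ∀ x, cosPolyDeriv c x ^ 2 =
      ∑ i : Fin (k + 1), ∑ j : Fin (k + 1), ((i : ℕ) * c i) * ((j : ℕ) * c j) *
        (sin ((i : ℕ) * x) * sin ((j : ℕ) * x)) := by
    intro x
    rw [cosPolyDeriv, sq, Finset.sum_mul_sum]
    exact Finset.sum_congr rfl fun i _ => Finset.sum_congr rfl fun j _ => by ring
  simp_rw [e]
  rw [intervalIntegral.integral_finsetSum
    fun i _ => Continuous.intervalIntegrable (by fun_prop) _ _]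
  refine Finset.sum_congr rfl fun i _ => ?_
  rw [intervalIntegral.integral_finsetSum
    fun i _ => Continuous.intervalIntegrable (by fun_prop) _ _]
  simp_rw [intervalIntegral.integral_const_mul, integral_sin_mul_sin, Fin.val_inj]
  simp [sq]

theorem integral_cosPolyDeriv_sq_le :
    ∫ x in (0 : ℝ)..π, cosPolyDeriv c x ^ 2 ≤ (k : ℝ) ^ 2 * ∫ x in (0 : ℝ)..π, cosPoly c x ^ 2 := by
  rw [integral_cosPolyDeriv_sq, integral_cosPoly_sq, Finset.mul_sum]
  refine Finset.sum_le_sum fun j _ => ?_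
  have hj : ((j : ℕ) : ℝ) ≤ k := by exact_mod_cast Nat.lt_succ_iff.mp j.2
  have hj2 : ((j : ℕ) : ℝ) ^ 2 ≤ (k : ℝ) ^ 2 := by gcongr
  have hπ := pi_pos
  split_ifs
  · rw [mul_zero]; positivity
  · rw [mul_pow, ← mul_assoc]
    gcongr

theorem sum_sq_le_integral_cosPoly_sq :
    π / 2 * ∑ j, c j ^ 2 ≤ ∫ x in (0 : ℝ)..π, cosPoly c x ^ 2 := by
  rw [integral_cosPoly_sq, Finset.mul_sum]
  refine Finset.sum_le_sum fun j _ => ?_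
  rw [mul_comm]
  gcongr
  split_ifs <;> linarith [pi_pos]

theorem cosPoly_sq_le (θ : ℝ) :
    cosPoly c θ ^ 2 ≤ (k + 1) * (2 / π) * ∫ x in (0 : ℝ)..π, cosPoly c x ^ 2 := by
  have hcs : cosPoly c θ ^ 2 ≤ (∑ j, c j ^ 2) * ∑ j : Fin (k + 1), cos ((j : ℕ) * θ) ^ 2 :=
    Finset.sum_mul_sq_le_sq_mul_sq _ _ _
  have hcos : ∑ j : Fin (k + 1), cos ((j : ℕ) * θ) ^ 2 ≤ k + 1 := by
    refine (Finset.sum_le_sum fun j _ => cos_sq_le_one _).trans ?_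
    simp
  have hπ := pi_pos
  have hI : ∑ j, c j ^ 2 ≤ 2 / π * ∫ x in (0 : ℝ)..π, cosPoly c x ^ 2 := by
    have := mul_le_mul_of_nonneg_left (sum_sq_le_integral_cosPoly_sq c) (by positivity : 0 ≤ 2 / π)
    rwa [← mul_assoc, show 2 / π * (π / 2) = 1 by field_simp, one_mul] at this
  calc _ ≤ _ := hcs
    _ ≤ (∑ j, c j ^ 2) * (k + 1) := by gcongr
    _ ≤ (2 / π * ∫ x in (0 : ℝ)..π, cosPoly c x ^ 2) * (k + 1) := by gcongr
    _ = _ := by ring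

theorem integral_cosPoly_sq_nonneg : 0 ≤ ∫ x in (0 : ℝ)..π, cosPoly c x ^ 2 :=
  intervalIntegral.integral_nonneg pi_pos.le fun _ _ => sq_nonneg _

theorem eq_zero_of_integral_cosPoly_sq_eq_zero
    (h : ∫ x in (0 : ℝ)..π, cosPoly c x ^ 2 = 0) : c = 0 := by
  have h1 := sum_sq_le_integral_cosPoly_sq c
  have h2 : ∑ j, c j ^ 2 ≤ 0 := by nlinarith [pi_pos]
  have h3 := (Finset.sum_eq_zero_iff_of_nonneg fun j _ => sq_nonneg (c j)).mp
    (h2.antisymm (Finset.sum_nonneg fun j _ => sq_nonneg (c j)))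
  ext j
  simpa using h3 j (Finset.mem_univ j)

end CosPoly

/-- Composition of cosine polynomials with `φ`, as a linear map in the coefficients. -/
noncomputable def cosPolyComp (k : ℕ) (φ : ℝ → ℝ) : (Fin (k + 1) → ℝ) →ₗ[ℝ] (ℝ → ℝ) where
  toFun c x := cosPoly c (φ x)
  map_add' c d := by
    ext x
    simp [cosPoly, add_mul, Finset.sum_add_distrib]
  map_smul' r c := by
    ext x
    simp [cosPoly, Finset.mul_sum, mul_assoc]

theorem exists_continuous_clamped_approx {σ : ℝ → ℝ} {d a ε : ℝ} (hd : d ≤ 1) (hε : 0 < ε)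
    (hσ : ∀ x ∈ Set.Ioo 0 a, d ≤ σ x ∧ σ x ≤ 1) (hint : IntegrableOn σ (Set.Ioo 0 a)) :
    ∃ g : ℝ → ℝ, Continuous g ∧ (∀ x, d ≤ g x ∧ g x ≤ 1) ∧
      ∫ x in Set.Ioo 0 a, |g x - σ x| ≤ ε := by
  obtain ⟨f, -, hf, hfc, hfi⟩ := hint.exists_hasCompactSupport_integral_sub_le hε
  refine ⟨fun x => max d (min 1 (f x)), by fun_prop,
    fun x => ⟨le_max_left _ _, max_le hd (min_le_left _ _)⟩, le_trans ?_ hf⟩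
  refine integral_mono_of_nonneg (ae_of_all _ fun x => abs_nonneg _) (hint.sub hfi).norm ?_
  filter_upwards [ae_restrict_mem measurableSet_Ioo] with x hx
  have hx' := hσ x hx
  have e : σ x = max d (min 1 (σ x)) := by
    rw [min_eq_right hx'.2, max_eq_right hx'.1]
  rw [norm_eq_abs, abs_sub_comm (σ x)]
  calc |max d (min 1 (f x)) - σ x| = |max d (min 1 (f x)) - max d (min 1 (σ x))| := by rw [← e]
    _ ≤ |min 1 (f x) - min 1 (σ x)| := by
      rw [max_comm d, max_comm d]
      exact abs_max_sub_max_le_abs _ _ _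
    _ ≤ |f x - σ x| := by
      rw [min_comm 1, min_comm 1]
      exact abs_inf_sub_inf_le_abs _ _ _

theorem muSL_one_le_of_approx {k : ℕ} {σ g : ℝ → ℝ} {d a ε : ℝ} (hd : 0 < d) (ha : 0 < a)
    (hint : IntegrableOn σ (Set.Ioo 0 a))
    (hg : Continuous g) (hgb : ∀ x, d ≤ g x ∧ g x ≤ 1)
    (hgσ : ∫ x in Set.Ioo 0 a, |g x - σ x| ≤ ε)
    (hpos : 0 < (∫ x in Set.Ioo 0 a, σ x) - (2 * k + 3) * ε) :
    muSL k 0 a (fun _ => 1) σ ≤ ENNReal.ofReal (π ^ 2 * (k : ℝ) ^ 2 /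
      (((∫ x in Set.Ioo 0 a, σ x) - ε) * ((∫ x in Set.Ioo 0 a, σ x) - (2 * k + 3) * ε))) := by
  have hπ := pi_pos
  set M := ∫ x in Set.Ioo 0 a, σ x with hM
  set m := ∫ x in (0 : ℝ)..a, g x with hm
  have hIoo : ∀ f : ℝ → ℝ, ∫ x in Set.Ioo 0 a, f x = ∫ x in (0 : ℝ)..a, f x := fun f => by
    rw [intervalIntegral.integral_of_le ha.le, integral_Ioc_eq_integral_Ioo]
  have hcont : ∀ f : ℝ → ℝ, Continuous f → IntegrableOn f (Set.Ioo 0 a) := fun f hf =>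
    (hf.continuousOn.integrableOn_compact isCompact_Icc).mono_set Ioo_subset_Icc_self
  have hε : 0 ≤ ε := (integral_nonneg fun x => abs_nonneg _).trans hgσ
  have hmM : M - ε ≤ m := by
    have h1 : m - M = ∫ x in Set.Ioo 0 a, (g x - σ x) := by
      rw [hm, ← hIoo, hM, ← integral_sub (hcont g hg) hint]
    have h2 := abs_integral_le_integral_abs (μ := volume.restrict (Set.Ioo 0 a))
      (f := fun x => g x - σ x)
    rw [← h1] at h2
    linarith [neg_abs_le (m - M)]
  have hk : (0 : ℝ) ≤ k := k.cast_nonneg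
  have hm0 : 0 < m := by nlinarith
  set φ : ℝ → ℝ := fun x => π / m * ∫ t in (0 : ℝ)..x, g t with hφdef
  have hφ : ∀ x, HasDerivAt φ (π / m * g x) x := fun x =>
    (hg.integral_hasStrictDerivAt 0 x).hasDerivAt.const_mul _
  have hφ0 : φ 0 = 0 := by simp [φ]
  have hφa : φ a = π := by
    simp only [hφdef]
    rw [← hm]
    field_simp
  have hφd : deriv φ = fun x => π / m * g x := funext fun x => (hφ x).deriv
  have hφ1 : ContDiff ℝ 1 φ := by
    rw [contDiff_one_iff_deriv, hφd]
    exact ⟨fun x => (hφ x).differentiableAt, by fun_prop⟩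
  have hφc : Continuous φ := hφ1.continuous
  have hsub : ∀ w : ℝ → ℝ, Continuous w →
      ∫ x in Set.Ioo 0 a, g x * w (φ x) = m / π * ∫ x in (0 : ℝ)..π, w x := by
    intro w hw
    have h := intervalIntegral.integral_comp_mul_deriv (a := 0) (b := a)
      (fun x _ => hφ x) (by fun_prop : ContinuousOn (fun x => π / m * g x) _) hw
    rw [hφ0, hφa] at h
    rw [hIoo, ← h, ← intervalIntegral.integral_const_mul]
    refine intervalIntegral.integral_congr fun x _ => ?_
    simp only [Function.comp]
    field_simp
  have hw : ∀ c : Fin (k + 1) → ℝ, Continuous (cosPoly c) := fun c =>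
    (contDiff_cosPoly c).continuous
  have hw' : ∀ c : Fin (k + 1) → ℝ, Continuous (cosPolyDeriv c) := continuous_cosPolyDeriv
  have hinj : Function.Injective ((indicatorL (Set.Ioo 0 a)).comp (cosPolyComp k φ)) := by
    rw [← LinearMap.ker_eq_bot, LinearMap.ker_eq_bot']
    intro c hc
    apply eq_zero_of_integral_cosPoly_sq_eq_zero
    have h0 : ∫ x in Set.Ioo 0 a, g x * cosPoly c (φ x) ^ 2 = 0 := by
      rw [setIntegral_congr_fun (g := fun _ => 0) measurableSet_Ioo]
      · simp
      · intro x hx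
        have : cosPoly c (φ x) = 0 := by
          have := congrFun hc x
          simpa [indicatorL, cosPolyComp, Set.indicator_of_mem hx] using this
        simp [this]
    rw [hsub (fun y => cosPoly c y ^ 2) ((hw c).pow 2)] at h0
    exact (mul_eq_zero.mp h0).resolve_left (by positivity)
  refine iInf_le_of_le ⟨LinearMap.range (cosPolyComp k φ), ?_, ?_⟩ (iSup_le ?_)
  · rintro _ ⟨c, rfl⟩
    exact (contDiff_cosPoly c).comp hφ1
  · rw [← LinearMap.range_comp, LinearMap.finrank_range_of_inj hinj]
    simp
  rintro ⟨_, ⟨c, rfl⟩, hne⟩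
  refine ENNReal.ofReal_le_ofReal ?_
  set I := ∫ x in (0 : ℝ)..π, cosPoly c x ^ 2 with hI
  have hI0 : 0 < I := by
    refine lt_of_le_of_ne (integral_cosPoly_sq_nonneg c) fun h => hne ?_
    rw [eq_zero_of_integral_cosPoly_sq_eq_zero c h.symm, map_zero, map_zero]
  have hderiv : ∀ x, deriv (cosPolyComp k φ c) x = cosPolyDeriv c (φ x) * (π / m * g x) :=
    fun x => ((hasDerivAt_cosPoly c (φ x)).comp x (hφ x)).deriv
  have hnum : ∫ x in Set.Ioo 0 a, 1 * (deriv (cosPolyComp k φ c) x) ^ 2 ≤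
      π / m * (k ^ 2 * I) := by
    calc ∫ x in Set.Ioo 0 a, 1 * (deriv (cosPolyComp k φ c) x) ^ 2
        ≤ ∫ x in Set.Ioo 0 a, (π / m) ^ 2 * (g x * cosPolyDeriv c (φ x) ^ 2) := by
          refine integral_mono_of_nonneg (ae_of_all _ fun x => by positivity)
            (hcont _ (by fun_prop)) (ae_of_all _ fun x => ?_)
          have hgx := hgb x
          have : g x ^ 2 ≤ g x := by nlinarith
          calc 1 * (deriv (cosPolyComp k φ c) x) ^ 2
              = (π / m) ^ 2 * (g x ^ 2 * cosPolyDeriv c (φ x) ^ 2) := by rw [hderiv]; ring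
            _ ≤ (π / m) ^ 2 * (g x * cosPolyDeriv c (φ x) ^ 2) := by gcongr
      _ = π / m * ∫ x in (0 : ℝ)..π, cosPolyDeriv c x ^ 2 := by
          rw [integral_const_mul, hsub (fun y => cosPolyDeriv c y ^ 2) ((hw' c).pow 2)]
          field_simp
      _ ≤ _ := by
          gcongr
          exact integral_cosPolyDeriv_sq_le c
  have hden : (M - (2 * k + 3) * ε) / π * I ≤
      ∫ x in Set.Ioo 0 a, σ x * (cosPolyComp k φ c x) ^ 2 := by
    set B := (k + 1) * (2 / π) * I with hB
    have hB0 : 0 ≤ B := by positivity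
    have hg2 : IntegrableOn (fun x => g x * cosPoly c (φ x) ^ 2) (Set.Ioo 0 a) :=
      hcont _ (by fun_prop)
    have habs : IntegrableOn (fun x => B * |g x - σ x|) (Set.Ioo 0 a) :=
      (((hcont g hg).sub hint).abs).const_mul B
    have hmono : ∫ x in Set.Ioo 0 a, (g x * cosPoly c (φ x) ^ 2 - B * |g x - σ x|) ≤
        ∫ x in Set.Ioo 0 a, σ x * (cosPolyComp k φ c x) ^ 2 := by
      refine integral_mono (hg2.sub habs) ?_ fun x => ?_
      · exact hint.mul_continuousOn_of_subset (K := Set.Icc 0 a)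
          (g' := fun x => cosPoly c (φ x) ^ 2) (by fun_prop) measurableSet_Ioo isCompact_Icc
          Ioo_subset_Icc_self
      · have h1 : cosPoly c (φ x) ^ 2 ≤ B := cosPoly_sq_le c (φ x)
        change g x * cosPoly c (φ x) ^ 2 - B * |g x - σ x| ≤ σ x * cosPoly c (φ x) ^ 2
        nlinarith [le_abs_self (g x - σ x), abs_nonneg (g x - σ x), sq_nonneg (cosPoly c (φ x)),
          mul_le_mul_of_nonneg_right h1 (abs_nonneg (g x - σ x)),
          mul_le_mul_of_nonneg_left (le_abs_self (g x - σ x)) (sq_nonneg (cosPoly c (φ x)))]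
    rw [integral_sub hg2 habs, integral_const_mul,
      hsub (fun y => cosPoly c y ^ 2) ((hw c).pow 2), ← hI] at hmono
    refine le_trans ?_ hmono
    have h2 : B * ∫ x in Set.Ioo 0 a, |g x - σ x| ≤ B * ε := by gcongr
    have h3 : (M - (2 * k + 3) * ε) / π * I = (M - ε) / π * I - B * ε := by
      rw [hB]
      field_simp
      ring
    have h4 : (M - ε) / π * I ≤ m / π * I := by gcongr
    linarith
  have hMε : 0 < M - ε := by nlinarith
  calc _ ≤ π / m * (k ^ 2 * I) / ((M - (2 * k + 3) * ε) / π * I) :=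
        div_le_div₀ (by positivity) hnum (by positivity) hden
    _ = π ^ 2 * k ^ 2 / (m * (M - (2 * k + 3) * ε)) := by field_simp
    _ ≤ _ := by gcongr

theorem muSL_one_le {k : ℕ} {σ : ℝ → ℝ} {d a : ℝ} (hd : 0 < d) (ha : 0 < a)
    (hmeas : Measurable σ) (hσ : ∀ x ∈ Set.Ioo 0 a, d ≤ σ x ∧ σ x ≤ 1) :
    muSL k 0 a (fun _ => 1) σ ≤
      ENNReal.ofReal (π ^ 2 * (k : ℝ) ^ 2 / (∫ x in Set.Ioo 0 a, σ x) ^ 2) := by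
  have hint : IntegrableOn σ (Set.Ioo 0 a) := by
    refine Measure.integrableOn_of_bounded (M := 1) (by simp) hmeas.aestronglyMeasurable ?_
    filter_upwards [ae_restrict_mem measurableSet_Ioo] with x hx
    rw [norm_eq_abs, abs_of_nonneg (hd.le.trans (hσ x hx).1)]
    exact (hσ x hx).2
  have hd1 : d ≤ 1 := (hσ (a / 2) ⟨by linarith, by linarith⟩).1.trans
    (hσ (a / 2) ⟨by linarith, by linarith⟩).2
  set M := ∫ x in Set.Ioo 0 a, σ x with hM
  have hM0 : 0 < M := by
    have h := setIntegral_mono_on (f := fun _ => d) (by simp) hint measurableSet_Ioo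
      fun x hx => (hσ x hx).1
    have h' : (0 : ℝ) < a * d := by positivity
    simp [ha.le] at h
    linarith
  have hlim : Filter.Tendsto (fun ε : ℝ => ENNReal.ofReal (π ^ 2 * (k : ℝ) ^ 2 /
      ((M - ε) * (M - (2 * k + 3) * ε)))) (nhdsWithin 0 (Set.Ioi 0))
      (nhds (ENNReal.ofReal (π ^ 2 * (k : ℝ) ^ 2 / M ^ 2))) := by
    refine (ENNReal.tendsto_ofReal ?_).mono_left nhdsWithin_le_nhds
    have hc : ContinuousAt (fun ε : ℝ => π ^ 2 * (k : ℝ) ^ 2 /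
        ((M - ε) * (M - (2 * k + 3) * ε))) 0 := by
      refine ContinuousAt.div (by fun_prop) (by fun_prop) ?_
      simp [hM0.ne']
    simpa [sq] using hc.tendsto
  refine ge_of_tendsto hlim ?_
  have hev : ∀ᶠ ε : ℝ in nhdsWithin 0 (Set.Ioi 0), 0 < M - (2 * k + 3) * ε := by
    refine Filter.Eventually.filter_mono nhdsWithin_le_nhds ?_
    have hc : ContinuousAt (fun ε : ℝ => M - (2 * k + 3) * ε) 0 := by fun_prop
    exact hc.eventually (lt_mem_nhds (by simpa using hM0))
  filter_upwards [hev, self_mem_nhdsWithin] with ε hpos hε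
  obtain ⟨g, hg, hgb, hgσ⟩ := exists_continuous_clamped_approx hd1 hε hσ hint
  exact muSL_one_le_of_approx hd ha hint hg hgb hgσ hpos

/-- Monotonicity chain for two-weight eigenvalues on an interval: if
`∫ρ₂ ≥ ∫ρ₁` and `α ∈ (0,1)` is chosen so that `α ∫ρ₂ = ∫ρ₁`, then
`μ_k(ρ₁,ρ₂) ≤ μ_k(ρ₁,αρ₂) ≤ μ_k(1,αρ₂)`; hence `μ_k(ρ₁,ρ₂) ≤ π²k²/(∫ρ₁)²`. -/
theorem stmt_9 (δ a : ℝ) (hδ : 0 < δ) (ha : 0 < a) (ρ₁ ρ₂ : ℝ → ℝ)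
    (hm1 : Measurable ρ₁) (hm2 : Measurable ρ₂)
    (h1 : ∀ x ∈ Set.Ioo 0 a, δ ≤ ρ₁ x ∧ ρ₁ x ≤ 1)
    (h2 : ∀ x ∈ Set.Ioo 0 a, δ ≤ ρ₂ x ∧ ρ₂ x ≤ 1)
    (hge : (∫ x in Set.Ioo 0 a, ρ₁ x) ≤ ∫ x in Set.Ioo 0 a, ρ₂ x)
    (αc : ℝ) (hαc0 : 0 < αc) (hαc1 : αc ≤ 1)
    (hαc : αc * ∫ x in Set.Ioo 0 a, ρ₂ x = ∫ x in Set.Ioo 0 a, ρ₁ x) (k : ℕ) :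
    muSL k 0 a ρ₁ ρ₂ ≤ muSL k 0 a ρ₁ (fun x => αc * ρ₂ x) ∧
    muSL k 0 a ρ₁ (fun x => αc * ρ₂ x) ≤ muSL k 0 a (fun _ => 1) (fun x => αc * ρ₂ x) ∧
    muSL k 0 a ρ₁ ρ₂ ≤
      ENNReal.ofReal (π ^ 2 * (k : ℝ) ^ 2 / (∫ x in Set.Ioo 0 a, ρ₁ x) ^ 2) := by
  have hpos1 : ∀ᵐ x ∂volume.restrict (Set.Ioo 0 a), 0 ≤ ρ₁ x ∧ ρ₁ x ≤ 1 := by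
    filter_upwards [ae_restrict_mem measurableSet_Ioo] with x hx
    exact ⟨hδ.le.trans (h1 x hx).1, (h1 x hx).2⟩
  have hnum : ∀ u : ℝ → ℝ, 0 ≤ ∫ x in Set.Ioo 0 a, ρ₁ x * (deriv u x) ^ 2 := fun u =>
    integral_nonneg_of_ae (hpos1.mono fun x hx => mul_nonneg hx.1 (sq_nonneg _))
  have hden : ∀ u : ℝ → ℝ, 0 ≤ ∫ x in Set.Ioo 0 a, ρ₂ x * (u x) ^ 2 := fun u =>
    setIntegral_nonneg measurableSet_Ioo fun x hx =>
      mul_nonneg (hδ.le.trans (h2 x hx).1) (sq_nonneg _)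
  have hαden : ∀ u : ℝ → ℝ, ∫ x in Set.Ioo 0 a, αc * ρ₂ x * (u x) ^ 2 =
      αc * ∫ x in Set.Ioo 0 a, ρ₂ x * (u x) ^ 2 := fun u => by
    simp_rw [mul_assoc, integral_const_mul]
  have hfst : muSL k 0 a ρ₁ ρ₂ ≤ muSL k 0 a ρ₁ (fun x => αc * ρ₂ x) := by
    refine muSL_mono fun u _ => ?_
    rw [hαden]
    rcases (hden u).eq_or_lt with h | h
    · simp [← h]
    · exact div_le_div_of_nonneg_left (hnum u) (by positivity) (mul_le_of_le_one_left h.le hαc1)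
  have hsnd : muSL k 0 a ρ₁ (fun x => αc * ρ₂ x) ≤
      muSL k 0 a (fun _ => 1) (fun x => αc * ρ₂ x) := by
    refine muSL_mono fun u hu => ?_
    refine div_le_div_of_nonneg_right ?_ (by rw [hαden]; exact mul_nonneg hαc0.le (hden u))
    refine integral_mono_of_nonneg (hpos1.mono fun x hx => mul_nonneg hx.1 (sq_nonneg _)) ?_
      (hpos1.mono fun x hx => mul_le_mul_of_nonneg_right hx.2 (sq_nonneg _))
    have hc : Continuous fun x => 1 * (deriv u x) ^ 2 :=
      continuous_const.mul ((hu.continuous_deriv le_rfl).pow 2)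
    exact (hc.continuousOn.integrableOn_compact isCompact_Icc).mono_set Ioo_subset_Icc_self
  refine ⟨hfst, hsnd, hfst.trans (hsnd.trans ?_)⟩
  have h := muSL_one_le (k := k) (σ := fun x => αc * ρ₂ x) (mul_pos hαc0 hδ) ha
    (hm2.const_mul αc) fun x hx =>
      ⟨mul_le_mul_of_nonneg_left (h2 x hx).1 hαc0.le,
        mul_le_one₀ hαc1 (hδ.le.trans (h2 x hx).1) (h2 x hx).2⟩
  rwa [integral_const_mul, hαc] at h
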